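/- arXiv:2006.02511 — 3 statements merged into one kernel-verified Lean document; each statement's English description precedes it below -/
import Mathlib

section
/- Let X ∈ End(V) act tridiagonally on the eigenspaces of A. Then W^{-2}XW^{2} = X + [A,[A,X]_q]/((q − q^{-1})(q^2 − q^{-2})) and W^{2}XW^{-2} = X + [A,[A,X]_{q^{-1}}]/((q − q^{-1})(q^2 − q^{-2})). -/
section OrthogonalIdempotents

variable {F R : Type*} [Field F] [Ring R] [Algebra F R]

theorem mul_sum_smul_of_orthogonal {n : ℕ} {E : ℕ → R}
    (hE : ∀ i j : ℕ, i ≤ n → j ≤ n → E i * E j = if i = j then E i else 0)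
    (f : ℕ → F) {i : ℕ} (hi : i ≤ n) :
    E i * ∑ k ∈ Finset.range (n + 1), f k • E k = f i • E i := by
  rw [Finset.mul_sum, Finset.sum_eq_single i]
  · rw [mul_smul_comm, hE i i hi hi, if_pos rfl]
  · intro k hk hki
    rw [mul_smul_comm, hE i k hi (Nat.lt_succ_iff.mp (Finset.mem_range.mp hk)),
      if_neg hki.symm, smul_zero]
  · intro h
    exact absurd (Finset.mem_range.mpr (Nat.lt_succ_of_le hi)) h

theorem sum_smul_mul_of_orthogonal {n : ℕ} {E : ℕ → R}
    (hE : ∀ i j : ℕ, i ≤ n → j ≤ n → E i * E j = if i = j then E i else 0)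
    (f : ℕ → F) {i : ℕ} (hi : i ≤ n) :
    (∑ k ∈ Finset.range (n + 1), f k • E k) * E i = f i • E i := by
  rw [Finset.sum_mul, Finset.sum_eq_single i]
  · rw [smul_mul_assoc, hE i i hi hi, if_pos rfl]
  · intro k hk hki
    rw [smul_mul_assoc, hE k i (Nat.lt_succ_iff.mp (Finset.mem_range.mp hk)) hi,
      if_neg hki, smul_zero]
  · intro h
    exact absurd (Finset.mem_range.mpr (Nat.lt_succ_of_le hi)) h

theorem eq_of_forall_mul_mul_eq {n : ℕ} {E : ℕ → R}
    (hsum : ∑ i ∈ Finset.range (n + 1), E i = 1) {Y Z : R}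
    (h : ∀ i j : ℕ, i ≤ n → j ≤ n → E i * Y * E j = E i * Z * E j) : Y = Z := by
  have expand (T : R) : T = ∑ i ∈ Finset.range (n + 1), ∑ j ∈ Finset.range (n + 1),
      E i * T * E j := by
    simp_rw [← Finset.mul_sum, ← Finset.sum_mul, hsum, one_mul, mul_one]
  rw [expand Y, expand Z]
  refine Finset.sum_congr rfl fun i hi => Finset.sum_congr rfl fun j hj => ?_
  exact h i j (Nat.lt_succ_iff.mp (Finset.mem_range.mp hi))
    (Nat.lt_succ_iff.mp (Finset.mem_range.mp hj))

theorem mul_conj_mul_eq_smul {e f S T : R} {s t : F} (he : e * S = s • e) (hf : T * f = t • f)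
    (X : R) : e * (S * S * X * (T * T)) * f = (s ^ 2 * t ^ 2) • (e * X * f) := by
  have hf' (Y : R) : Y * T * f = t • (Y * f) := by rw [mul_assoc, hf, mul_smul_comm]
  simp only [← mul_assoc, he, hf', smul_mul_assoc, smul_smul]
  congr 1
  ring

theorem mul_commutator_mul_eq_smul {e f A : R} {x y : F} (he : e * A = x • e)
    (hf : A * f = y • f) (p r c : F) (X : R) :
    e * (X + c • (A * (p • (A * X) - r • (X * A)) - (p • (A * X) - r • (X * A)) * A)) * f
      = (1 + c * ((x - y) * (p * x - r * y))) • (e * X * f) := by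
  have hf' (Y : R) : Y * A * f = y • (Y * f) := by rw [mul_assoc, hf, mul_smul_comm]
  simp only [mul_add, add_mul, mul_sub, sub_mul, mul_smul_comm, smul_mul_assoc, ← mul_assoc,
    he, hf']
  module

end OrthogonalIdempotents

section Scalars

variable {F : Type*} [Field F]

/-- The relation between the ratio `u ^ 2` and the scalars `u q + (u q)⁻¹`, `u q⁻¹ + u⁻¹ q`
attached to two adjacent eigenspaces. -/
theorem one_add_commutator_coeff {q u : F} (hq : q ≠ 0) (hu : u ≠ 0)
    (hD : (q - q⁻¹) * (q ^ 2 - (q ^ 2)⁻¹) ≠ 0) {x y : F}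
    (hx : x = u * q + u⁻¹ * q⁻¹) (hy : y = u * q⁻¹ + u⁻¹ * q) :
    1 + ((q - q⁻¹) * (q ^ 2 - (q ^ 2)⁻¹))⁻¹ * ((x - y) * (q * x - q⁻¹ * y)) = u ^ 2 := by
  have h : (x - y) * (q * x - q⁻¹ * y) = (q - q⁻¹) * (q ^ 2 - (q ^ 2)⁻¹) * (u ^ 2 - 1) := by
    subst hx hy
    field_simp
    ring
  rw [h, inv_mul_cancel_left₀ hD]
  ring

theorem sub_inv_mul_sq_sub_inv_ne_zero {q : F} (hq : q ≠ 0) (hq4 : q ^ 4 ≠ 1) :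
    (q - q⁻¹) * (q ^ 2 - (q ^ 2)⁻¹) ≠ 0 := by
  refine mul_ne_zero (fun h => hq4 ?_) (fun h => hq4 ?_)
  · have h2 : q * q = 1 := by
      nth_rewrite 2 [sub_eq_zero.mp h]
      exact mul_inv_cancel₀ hq
    linear_combination (q * q + 1) * h2
  · have h2 : q ^ 2 * q ^ 2 = 1 := by
      nth_rewrite 2 [sub_eq_zero.mp h]
      exact mul_inv_cancel₀ (pow_ne_zero 2 hq)
    linear_combination h2

theorem coeff_succ {q a : F} (hq : q ≠ 0) (ha : a ≠ 0) {d i : ℕ} (hi : i + 1 ≤ d)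
    {θ t : ℕ → F}
    (hθ : ∀ i : ℕ, i ≤ d → θ i = a * q ^ ((d : ℤ) - 2 * (i : ℤ))
      + a⁻¹ * q ^ (2 * (i : ℤ) - (d : ℤ)))
    (ht : ∀ i : ℕ, i ≤ d → t i = (-1 : F) ^ i * a ^ i * q ^ (i * (d - i))) :
    ∃ u : F, u ≠ 0 ∧ θ i = u * q + u⁻¹ * q⁻¹ ∧ θ (i + 1) = u * q⁻¹ + u⁻¹ * q ∧
      t (i + 1) = -u * t i := by
  obtain ⟨k, rfl⟩ := Nat.exists_eq_add_of_le hi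
  refine ⟨a * q ^ ((k : ℤ) - i), mul_ne_zero ha (zpow_ne_zero _ hq), ?_, ?_, ?_⟩
  · rw [hθ i (by omega), mul_inv, ← zpow_neg, mul_assoc, mul_assoc, ← zpow_add_one₀ hq,
      ← zpow_sub_one₀ hq]
    push_cast
    ring_nf
  · rw [hθ (i + 1) (by omega), mul_inv, ← zpow_neg, mul_assoc, mul_assoc, ← zpow_add_one₀ hq,
      ← zpow_sub_one₀ hq]
    push_cast
    ring_nf
  · have hq' : q ^ ((i + 1) * k) = q ^ ((k : ℤ) - i) * q ^ (i * (k + 1)) := by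
      rw [← zpow_natCast, ← zpow_natCast, ← zpow_add₀ hq]
      push_cast
      ring_nf
    rw [ht i (by omega), ht (i + 1) (by omega), show i + 1 + k - (i + 1) = k by omega,
      show i + 1 + k - i = k + 1 by omega, hq']
    ring

end Scalars


theorem stmt5
    {F : Type*} [Field F] {V : Type*} [AddCommGroup V] [Module F V]
    [FiniteDimensional F V] [Nontrivial V]
    (q a : F) (hq0 : q ≠ 0) (ha0 : a ≠ 0) (hq4 : q ^ 4 ≠ 1)
    (d : ℕ) (hd : 1 ≤ d)
    (hq2i : ∀ i : ℕ, 1 ≤ i → i ≤ d → q ^ (2 * i) ≠ 1)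
    (ha2 : ∀ j : ℤ, 1 - (d : ℤ) ≤ j → j ≤ (d : ℤ) - 1 → a ^ 2 ≠ q ^ (2 * j))
    (θ : ℕ → F)
    (hθ : ∀ i : ℕ, i ≤ d → θ i = a * q ^ ((d : ℤ) - 2 * (i : ℤ)) + a⁻¹ * q ^ (2 * (i : ℤ) - (d : ℤ)))
    (hθdist : ∀ i j : ℕ, i ≤ d → j ≤ d → i ≠ j → θ i ≠ θ j)
    (A : Module.End F V) (E : ℕ → Module.End F V)
    (hEE : ∀ i j : ℕ, i ≤ d → j ≤ d → E i * E j = if i = j then E i else 0)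
    (hEsum : ∑ i ∈ Finset.range (d + 1), E i = 1)
    (hAE : A = ∑ i ∈ Finset.range (d + 1), θ i • E i)
    (hEne : ∀ i : ℕ, i ≤ d → E i ≠ 0)
    (t : ℕ → F)
    (ht : ∀ i : ℕ, i ≤ d → t i = (-1 : F) ^ i * a ^ i * q ^ (i * (d - i)))
    (W Winv : Module.End F V)
    (hW : W = ∑ i ∈ Finset.range (d + 1), t i • E i)
    (hWinv : Winv = ∑ i ∈ Finset.range (d + 1), (t i)⁻¹ • E i)
    (X : Module.End F V)
    (hX : (∀ i j : ℕ, i ≤ d → j ≤ d → (i + 1 < j ∨ j + 1 < i) → E i * X * E j = 0)) :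
    Winv * Winv * X * (W * W)
      = X + ((q - q⁻¹) * (q ^ 2 - (q ^ 2)⁻¹))⁻¹ •
          (A * (q • (A * X) - q⁻¹ • (X * A)) - (q • (A * X) - q⁻¹ • (X * A)) * A) ∧
    W * W * X * (Winv * Winv)
      = X + ((q - q⁻¹) * (q ^ 2 - (q ^ 2)⁻¹))⁻¹ •
          (A * (q⁻¹ • (A * X) - q • (X * A)) - (q⁻¹ • (A * X) - q • (X * A)) * A) := by
  have hD := sub_inv_mul_sq_sub_inv_ne_zero hq0 hq4
  have ht0 (i : ℕ) (hi : i ≤ d) : t i ≠ 0 := by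
    rw [ht i hi]
    exact mul_ne_zero (mul_ne_zero (pow_ne_zero _ (neg_ne_zero.mpr one_ne_zero))
      (pow_ne_zero _ ha0)) (pow_ne_zero _ hq0)
  have key (i j : ℕ) (hi : i ≤ d) (hj : j ≤ d) (hij : ¬(i + 1 < j ∨ j + 1 < i)) :
      (t i)⁻¹ ^ 2 * t j ^ 2 = 1 + ((q - q⁻¹) * (q ^ 2 - (q ^ 2)⁻¹))⁻¹ *
        ((θ i - θ j) * (q * θ i - q⁻¹ * θ j)) := by
    have hti := ht0 i hi
    have htj := ht0 j hj
    obtain rfl | rfl | rfl : j = i ∨ j = i + 1 ∨ i = j + 1 := by omega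
    · rw [sub_self, zero_mul, mul_zero, add_zero, ← mul_pow, inv_mul_cancel₀ hti, one_pow]
    · obtain ⟨u, hu, hx, hy, htu⟩ := coeff_succ hq0 ha0 hj hθ ht
      rw [one_add_commutator_coeff hq0 hu hD hx hy, htu]
      field_simp
    · obtain ⟨u, hu, hx, hy, htu⟩ := coeff_succ hq0 ha0 hi hθ ht
      rw [one_add_commutator_coeff hq0 (inv_ne_zero hu) hD
        (by rw [hy, inv_inv]; ring) (by rw [hx, inv_inv]; ring), htu]
      field_simp
  have hA_left (i : ℕ) (hi : i ≤ d) : E i * A = θ i • E i :=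
    hAE ▸ mul_sum_smul_of_orthogonal hEE θ hi
  have hA_right (i : ℕ) (hi : i ≤ d) : A * E i = θ i • E i :=
    hAE ▸ sum_smul_mul_of_orthogonal hEE θ hi
  have hW_left (i : ℕ) (hi : i ≤ d) : E i * W = t i • E i :=
    hW ▸ mul_sum_smul_of_orthogonal hEE t hi
  have hW_right (i : ℕ) (hi : i ≤ d) : W * E i = t i • E i :=
    hW ▸ sum_smul_mul_of_orthogonal hEE t hi
  have hWinv_left (i : ℕ) (hi : i ≤ d) : E i * Winv = (t i)⁻¹ • E i :=
    hWinv ▸ mul_sum_smul_of_orthogonal hEE (fun k => (t k)⁻¹) hi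
  have hWinv_right (i : ℕ) (hi : i ≤ d) : Winv * E i = (t i)⁻¹ • E i :=
    hWinv ▸ sum_smul_mul_of_orthogonal hEE (fun k => (t k)⁻¹) hi
  constructor <;> refine eq_of_forall_mul_mul_eq hEsum fun i j hi hj => ?_
  · rw [mul_conj_mul_eq_smul (hWinv_left i hi) (hW_right j hj),
      mul_commutator_mul_eq_smul (hA_left i hi) (hA_right j hj)]
    by_cases hij : i + 1 < j ∨ j + 1 < i
    · rw [hX i j hi hj hij, smul_zero, smul_zero]
    · rw [key i j hi hj hij]
  · rw [mul_conj_mul_eq_smul (hW_left i hi) (hWinv_right j hj),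
      mul_commutator_mul_eq_smul (hA_left i hi) (hA_right j hj)]
    by_cases hij : i + 1 < j ∨ j + 1 < i
    · rw [hX i j hi hj hij, smul_zero, smul_zero]
    · rw [mul_comm (t i ^ 2), key j i hj hi (by omega)]
      congr 1
      ring
end

section
/- Let ψ, M, N, Q, Λ ∈ End(V) with M, N, Q invertible. Assume: ψ, M^{-1} and N^{-1} each act tridiagonally on the eigenspaces of A; Λ commutes with A; Q^{-1} = W^{-1}M^{-1}W = WN^{-1}W^{-1}; ψ + (qAM^{-1} − q^{-1}M^{-1}A)/(q^2 − q^{-2}) = ((a + a^{-1})/(q + q^{-1}))I; ψ + (qN^{-1}A − q^{-1}AN^{-1})/(q^2 − q^{-2}) = ((a + a^{-1})/(q + q^{-1}))I; M^{-1} + (qψA − q^{-1}Aψ)/(q^2 − q^{-2}) = Λ/(q + q^{-1}); and N^{-1} + (qAψ − q^{-1}ψA)/(q^2 − q^{-2}) = Λ/(q + q^{-1}). Then A commutes with ψ − Q^{-1}, and moreover WψW^{-1} + Q^{-1} = ψ + M^{-1} and W^{-1}ψW + Q^{-1} = ψ + N^{-1}. -/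
section Idempotents

variable {F B : Type*} [Field F] [Ring B] [Algebra F B] {d : ℕ} {E : ℕ → B}

lemma idempotent_mul_sum
    (hEE : ∀ i j : ℕ, i ≤ d → j ≤ d → E i * E j = if i = j then E i else 0)
    (s : ℕ → F) {i : ℕ} (hi : i ≤ d) :
    E i * ∑ k ∈ Finset.range (d + 1), s k • E k = s i • E i := by
  rw [Finset.mul_sum, Finset.sum_eq_single i]
  · rw [mul_smul_comm, hEE i i hi hi, if_pos rfl]
  · intro k hk hki
    rw [mul_smul_comm, hEE i k hi (Nat.lt_succ_iff.mp (Finset.mem_range.mp hk)),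
      if_neg hki.symm, smul_zero]
  · intro h
    exact absurd (Finset.mem_range.mpr (Nat.lt_succ_of_le hi)) h

lemma sum_mul_idempotent
    (hEE : ∀ i j : ℕ, i ≤ d → j ≤ d → E i * E j = if i = j then E i else 0)
    (s : ℕ → F) {j : ℕ} (hj : j ≤ d) :
    (∑ k ∈ Finset.range (d + 1), s k • E k) * E j = s j • E j := by
  rw [Finset.sum_mul, Finset.sum_eq_single j]
  · rw [smul_mul_assoc, hEE j j hj hj, if_pos rfl]
  · intro k hk hkj
    rw [smul_mul_assoc, hEE k j (Nat.lt_succ_iff.mp (Finset.mem_range.mp hk)) hj,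
      if_neg hkj, smul_zero]
  · intro h
    exact absurd (Finset.mem_range.mpr (Nat.lt_succ_of_le hj)) h

lemma ext_of_blocks (hEsum : ∑ i ∈ Finset.range (d + 1), E i = 1) {X Y : B}
    (h : ∀ i j : ℕ, i ≤ d → j ≤ d → E i * X * E j = E i * Y * E j) : X = Y := by
  have expand : ∀ Z : B, Z = ∑ i ∈ Finset.range (d + 1), ∑ j ∈ Finset.range (d + 1),
      E i * Z * E j := by
    intro Z
    simp_rw [← Finset.mul_sum, hEsum, mul_one, ← Finset.sum_mul, hEsum, one_mul]
  rw [expand X, expand Y]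
  refine Finset.sum_congr rfl fun i hi => Finset.sum_congr rfl fun j hj => ?_
  exact h i j (Nat.lt_succ_iff.mp (Finset.mem_range.mp hi))
    (Nat.lt_succ_iff.mp (Finset.mem_range.mp hj))

lemma sum_commute_of_blockDiagonal
    (hEE : ∀ i j : ℕ, i ≤ d → j ≤ d → E i * E j = if i = j then E i else 0)
    (hEsum : ∑ i ∈ Finset.range (d + 1), E i = 1) {D : B}
    (hD : ∀ i j : ℕ, i ≤ d → j ≤ d → i ≠ j → E i * D * E j = 0) (s : ℕ → F) :
    Commute (∑ k ∈ Finset.range (d + 1), s k • E k) D := by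
  refine ext_of_blocks hEsum fun i j hi hj => ?_
  rw [← mul_assoc (E i), idempotent_mul_sum hEE s hi, ← mul_assoc (E i) D, mul_assoc (E i * D),
    sum_mul_idempotent hEE s hj, smul_mul_assoc, smul_mul_assoc, mul_smul_comm]
  by_cases hij : i = j
  · rw [hij]
  · rw [hD i j hi hj hij, smul_zero, smul_zero]

lemma sum_mul_sum_inv
    (hEE : ∀ i j : ℕ, i ≤ d → j ≤ d → E i * E j = if i = j then E i else 0)
    (hEsum : ∑ i ∈ Finset.range (d + 1), E i = 1) {s r : ℕ → F}
    (hs : ∀ i ≤ d, s i * r i = 1) :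
    (∑ k ∈ Finset.range (d + 1), s k • E k) * (∑ k ∈ Finset.range (d + 1), r k • E k) = 1 := by
  rw [Finset.sum_mul, ← hEsum]
  refine Finset.sum_congr rfl fun i hi => ?_
  have hi' : i ≤ d := Nat.lt_succ_iff.mp (Finset.mem_range.mp hi)
  rw [smul_mul_assoc, idempotent_mul_sum hEE r hi', smul_smul, hs i hi', one_smul]

end Idempotents

section Scalars

variable {F : Type*} [Field F] {q a : F}

lemma sq_sub_inv_ne_zero (hq0 : q ≠ 0) (hq4 : q ^ 4 ≠ 1) : q ^ 2 - (q ^ 2)⁻¹ ≠ 0 := by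
  intro h
  apply hq4
  field_simp at h
  linear_combination h

lemma eigenvalue_ratio (hq0 : q ≠ 0) (ha0 : a ≠ 0) (hq4 : q ^ 4 ≠ 1) (i e : ℕ) :
    (q ^ 2 - (q ^ 2)⁻¹)⁻¹ * (q * (a * q ^ (((i + 1 + e : ℕ) : ℤ) - 2 * ((i + 1 : ℕ) : ℤ))
        + a⁻¹ * q ^ (2 * ((i + 1 : ℕ) : ℤ) - ((i + 1 + e : ℕ) : ℤ)))
      - q⁻¹ * (a * q ^ (((i + 1 + e : ℕ) : ℤ) - 2 * (i : ℤ))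
        + a⁻¹ * q ^ (2 * (i : ℤ) - ((i + 1 + e : ℕ) : ℤ)))) = a⁻¹ * q ^ i * (q ^ e)⁻¹ ∧
    (q ^ 2 - (q ^ 2)⁻¹)⁻¹ * (q * (a * q ^ (((i + 1 + e : ℕ) : ℤ) - 2 * (i : ℤ))
        + a⁻¹ * q ^ (2 * (i : ℤ) - ((i + 1 + e : ℕ) : ℤ)))
      - q⁻¹ * (a * q ^ (((i + 1 + e : ℕ) : ℤ) - 2 * ((i + 1 : ℕ) : ℤ))
        + a⁻¹ * q ^ (2 * ((i + 1 : ℕ) : ℤ) - ((i + 1 + e : ℕ) : ℤ)))) = a * q ^ e * (q ^ i)⁻¹ := by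
  have hc := sq_sub_inv_ne_zero hq0 hq4
  have h1 : q ^ (((i + 1 + e : ℕ) : ℤ) - 2 * ((i + 1 : ℕ) : ℤ)) = q ^ e * (q ^ i)⁻¹ * q⁻¹ := by
    rw [show ((i + 1 + e : ℕ) : ℤ) - 2 * ((i + 1 : ℕ) : ℤ) = (e : ℤ) + -(i : ℤ) + -1 by
      push_cast; ring, zpow_add₀ hq0, zpow_add₀ hq0, zpow_neg, zpow_neg_one, zpow_natCast,
      zpow_natCast]
  have h2 : q ^ (((i + 1 + e : ℕ) : ℤ) - 2 * (i : ℤ)) = q ^ e * (q ^ i)⁻¹ * q := by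
    rw [show ((i + 1 + e : ℕ) : ℤ) - 2 * (i : ℤ) = (e : ℤ) + -(i : ℤ) + 1 by
      push_cast; ring, zpow_add₀ hq0, zpow_add₀ hq0, zpow_neg, zpow_one, zpow_natCast,
      zpow_natCast]
  have h3 : q ^ (2 * ((i + 1 : ℕ) : ℤ) - ((i + 1 + e : ℕ) : ℤ))
      = (q ^ e * (q ^ i)⁻¹ * q⁻¹)⁻¹ := by
    rw [← h1, ← zpow_neg, neg_sub]
  have h4 : q ^ (2 * (i : ℤ) - ((i + 1 + e : ℕ) : ℤ)) = (q ^ e * (q ^ i)⁻¹ * q)⁻¹ := by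
    rw [← h2, ← zpow_neg, neg_sub]
  rw [h1, h2, h3, h4]
  have hi : q ^ i ≠ 0 := pow_ne_zero _ hq0
  have he : q ^ e ≠ 0 := pow_ne_zero _ hq0
  generalize q ^ i = x at *
  generalize q ^ e = y at *
  constructor
  · rw [inv_mul_eq_iff_eq_mul₀ hc]
    field_simp
    ring
  · rw [inv_mul_eq_iff_eq_mul₀ hc]
    field_simp
    ring

lemma weight_succ (i e : ℕ) :
    (-1 : F) ^ (i + 1) * a ^ (i + 1) * q ^ ((i + 1) * (i + 1 + e - (i + 1))) * q ^ i
      = -a * q ^ e * ((-1 : F) ^ i * a ^ i * q ^ (i * (i + 1 + e - i))) := by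
  rw [Nat.add_sub_cancel_left, add_assoc i 1 e, Nat.add_sub_cancel_left]
  ring

lemma weight_ne_zero (hq0 : q ≠ 0) (ha0 : a ≠ 0) (i n : ℕ) :
    (-1 : F) ^ i * a ^ i * q ^ n ≠ 0 := by
  simp [hq0, ha0]

lemma adjacent_weight_eigenvalue (hq0 : q ≠ 0) (ha0 : a ≠ 0) (hq4 : q ^ 4 ≠ 1) {d : ℕ}
    {θ t : ℕ → F}
    (hθ : ∀ i : ℕ, i ≤ d →
      θ i = a * q ^ ((d : ℤ) - 2 * (i : ℤ)) + a⁻¹ * q ^ (2 * (i : ℤ) - (d : ℤ)))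
    (ht : ∀ i : ℕ, i ≤ d → t i = (-1 : F) ^ i * a ^ i * q ^ (i * (d - i)))
    {i j : ℕ} (hi : i ≤ d) (hj : j ≤ d) (hij : j = i + 1 ∨ i = j + 1) :
    t j * ((q ^ 2 - (q ^ 2)⁻¹)⁻¹ * (q * θ j - q⁻¹ * θ i)) = -t i := by
  have key : ∀ k : ℕ, k + 1 ≤ d →
      t (k + 1) * ((q ^ 2 - (q ^ 2)⁻¹)⁻¹ * (q * θ (k + 1) - q⁻¹ * θ k)) = -t k ∧
      t k * ((q ^ 2 - (q ^ 2)⁻¹)⁻¹ * (q * θ k - q⁻¹ * θ (k + 1))) = -t (k + 1) := by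
    intro k hk
    obtain ⟨e, rfl⟩ := Nat.exists_eq_add_of_le hk
    have hx : q ^ k ≠ 0 := pow_ne_zero _ hq0
    have hy : q ^ e ≠ 0 := pow_ne_zero _ hq0
    have hw := weight_succ (q := q) (a := a) k e
    rw [← ht (k + 1) hk, ← ht k (by omega)] at hw
    obtain ⟨h1, h2⟩ := eigenvalue_ratio hq0 ha0 hq4 k e
    rw [hθ (k + 1) hk, hθ k (by omega), h1, h2]
    constructor
    · field_simp
      linear_combination hw
    · field_simp
      linear_combination hw
  rcases hij with rfl | rfl
  · exact (key i hj).1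
  · exact (key j hi).2

end Scalars


theorem stmt16
    {F : Type*} [Field F] {V : Type*} [AddCommGroup V] [Module F V]
    [FiniteDimensional F V] [Nontrivial V]
    (q a : F) (hq0 : q ≠ 0) (ha0 : a ≠ 0) (hq4 : q ^ 4 ≠ 1)
    (d : ℕ) (hd : 1 ≤ d)
    (hq2i : ∀ i : ℕ, 1 ≤ i → i ≤ d → q ^ (2 * i) ≠ 1)
    (ha2 : ∀ j : ℤ, 1 - (d : ℤ) ≤ j → j ≤ (d : ℤ) - 1 → a ^ 2 ≠ q ^ (2 * j))
    (θ : ℕ → F)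
    (hθ : ∀ i : ℕ, i ≤ d → θ i = a * q ^ ((d : ℤ) - 2 * (i : ℤ)) + a⁻¹ * q ^ (2 * (i : ℤ) - (d : ℤ)))
    (hθdist : ∀ i j : ℕ, i ≤ d → j ≤ d → i ≠ j → θ i ≠ θ j)
    (A : Module.End F V) (E : ℕ → Module.End F V)
    (hEE : ∀ i j : ℕ, i ≤ d → j ≤ d → E i * E j = if i = j then E i else 0)
    (hEsum : ∑ i ∈ Finset.range (d + 1), E i = 1)
    (hAE : A = ∑ i ∈ Finset.range (d + 1), θ i • E i)
    (hEne : ∀ i : ℕ, i ≤ d → E i ≠ 0)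
    (t : ℕ → F)
    (ht : ∀ i : ℕ, i ≤ d → t i = (-1 : F) ^ i * a ^ i * q ^ (i * (d - i)))
    (W Winv : Module.End F V)
    (hW : W = ∑ i ∈ Finset.range (d + 1), t i • E i)
    (hWinv : Winv = ∑ i ∈ Finset.range (d + 1), (t i)⁻¹ • E i)
    (ψ M N Q Minv Ninv Qinv Λ : Module.End F V)
    (hM : M * Minv = 1) (hM' : Minv * M = 1)
    (hN : N * Ninv = 1) (hN' : Ninv * N = 1)
    (hQ : Q * Qinv = 1) (hQ' : Qinv * Q = 1)
    (hψtri : (∀ i j : ℕ, i ≤ d → j ≤ d → (i + 1 < j ∨ j + 1 < i) → E i * ψ * E j = 0))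
    (hMtri : (∀ i j : ℕ, i ≤ d → j ≤ d → (i + 1 < j ∨ j + 1 < i) → E i * Minv * E j = 0))
    (hNtri : (∀ i j : ℕ, i ≤ d → j ≤ d → (i + 1 < j ∨ j + 1 < i) → E i * Ninv * E j = 0))
    (hΛA : A * Λ = Λ * A)
    (hQM : Qinv = Winv * Minv * W)
    (hQN : Qinv = W * Ninv * Winv)
    (heq1 : ψ + (q ^ 2 - (q ^ 2)⁻¹)⁻¹ • (q • (A * Minv) - q⁻¹ • (Minv * A))
        = ((a + a⁻¹) / (q + q⁻¹)) • 1)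
    (heq2 : ψ + (q ^ 2 - (q ^ 2)⁻¹)⁻¹ • (q • (Ninv * A) - q⁻¹ • (A * Ninv))
        = ((a + a⁻¹) / (q + q⁻¹)) • 1)
    (heq3 : Minv + (q ^ 2 - (q ^ 2)⁻¹)⁻¹ • (q • (ψ * A) - q⁻¹ • (A * ψ)) = (q + q⁻¹)⁻¹ • Λ)
    (heq4 : Ninv + (q ^ 2 - (q ^ 2)⁻¹)⁻¹ • (q • (A * ψ) - q⁻¹ • (ψ * A)) = (q + q⁻¹)⁻¹ • Λ) :
    A * (ψ - Qinv) = (ψ - Qinv) * A ∧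
    W * ψ * Winv + Qinv = ψ + Minv ∧
    Winv * ψ * W + Qinv = ψ + Ninv := by
  have htne : ∀ i ≤ d, t i ≠ 0 := fun i hi => by
    rw [ht i hi]
    exact weight_ne_zero hq0 ha0 _ _
  have hEA : ∀ i ≤ d, E i * A = θ i • E i := fun i hi => hAE ▸ idempotent_mul_sum hEE θ hi
  have hAEj : ∀ j ≤ d, A * E j = θ j • E j := fun j hj => hAE ▸ sum_mul_idempotent hEE θ hj
  have hΛ : ∀ i j : ℕ, i ≤ d → j ≤ d → i ≠ j → E i * Λ * E j = 0 := by
    intro i j hi hj hij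
    have h : E i * (A * Λ) * E j = E i * (Λ * A) * E j := by rw [hΛA]
    rw [← mul_assoc, hEA i hi, ← mul_assoc (E i) Λ, mul_assoc (E i * Λ), hAEj j hj,
      smul_mul_assoc, smul_mul_assoc, mul_smul_comm, ← sub_eq_zero, ← sub_smul] at h
    exact (smul_eq_zero.mp h).resolve_left (sub_ne_zero.mpr (hθdist i j hi hj hij))
  have hQblock : ∀ i j : ℕ, i ≤ d → j ≤ d →
      E i * Qinv * E j = ((t i)⁻¹ * t j) • (E i * Minv * E j) := by
    intro i j hi hj
    rw [hQM, hW, hWinv, ← mul_assoc, ← mul_assoc, idempotent_mul_sum hEE _ hi, mul_assoc,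
      sum_mul_idempotent hEE _ hj, smul_mul_assoc, smul_mul_assoc, mul_smul_comm, smul_smul]
  have hMblock : ∀ i j : ℕ, i ≤ d → j ≤ d → i ≠ j → E i * Minv * E j
      = (-((q ^ 2 - (q ^ 2)⁻¹)⁻¹ * (q * θ j - q⁻¹ * θ i))) • (E i * ψ * E j) := by
    intro i j hi hj hij
    have h := congrArg (fun X => E i * X * E j) heq3
    simp only [mul_add, add_mul, mul_sub, sub_mul, mul_smul_comm, smul_mul_assoc,
      hΛ i j hi hj hij, smul_zero] at h
    rw [← mul_assoc (E i) ψ A, mul_assoc (E i * ψ) A, hAEj j hj, ← mul_assoc (E i) A ψ,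
      hEA i hi, mul_smul_comm, smul_mul_assoc, smul_mul_assoc, smul_smul, smul_smul,
      ← sub_smul, smul_smul] at h
    rw [neg_smul]
    exact eq_neg_of_add_eq_zero_left h
  have hD : ∀ i j : ℕ, i ≤ d → j ≤ d → i ≠ j → E i * (ψ - Qinv) * E j = 0 := by
    intro i j hi hj hij
    rw [mul_sub, sub_mul, hQblock i j hi hj]
    by_cases hfar : i + 1 < j ∨ j + 1 < i
    · rw [hψtri i j hi hj hfar, hMtri i j hi hj hfar, smul_zero, sub_zero]
    · have hs := adjacent_weight_eigenvalue hq0 ha0 hq4 hθ ht hi hj (by omega)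
      have hone : (t i)⁻¹ * t j * -((q ^ 2 - (q ^ 2)⁻¹)⁻¹ * (q * θ j - q⁻¹ * θ i)) = 1 := by
        rw [mul_neg, mul_assoc, hs, mul_neg, neg_neg, inv_mul_cancel₀ (htne i hi)]
      rw [hMblock i j hi hj hij, smul_smul, hone, one_smul, sub_self]
  have hWW : W * Winv = 1 := by
    rw [hW, hWinv]
    exact sum_mul_sum_inv hEE hEsum fun i hi => mul_inv_cancel₀ (htne i hi)
  have hWW' : Winv * W = 1 := by
    rw [hW, hWinv]
    exact sum_mul_sum_inv hEE hEsum fun i hi => inv_mul_cancel₀ (htne i hi)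
  have hcomm := fun s : ℕ → F => sum_commute_of_blockDiagonal hEE hEsum hD s
  have hQW : W * Qinv * Winv = Minv := by
    rw [hQM, mul_assoc, mul_assoc, hWW, mul_one, ← mul_assoc, hWW, one_mul]
  have hQW' : Winv * Qinv * W = Ninv := by
    rw [hQN, mul_assoc, mul_assoc, hWW', mul_one, ← mul_assoc, hWW', one_mul]
  refine ⟨hAE ▸ (hcomm θ).eq, ?_, ?_⟩
  · have h : W * (ψ - Qinv) * Winv = ψ - Qinv := by
      rw [show W * (ψ - Qinv) = (ψ - Qinv) * W from hW ▸ (hcomm t).eq, mul_assoc, hWW, mul_one]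
    rw [mul_sub, sub_mul, hQW, sub_eq_sub_iff_add_eq_add] at h
    exact h
  · have h : Winv * (ψ - Qinv) * W = ψ - Qinv := by
      rw [show Winv * (ψ - Qinv) = (ψ - Qinv) * Winv from hWinv ▸ (hcomm fun i => (t i)⁻¹).eq,
        mul_assoc, hWW', mul_one]
    rw [mul_sub, sub_mul, hQW', sub_eq_sub_iff_add_eq_add] at h
    exact h
end

section
/- Let ψ, M, Q, Λ ∈ End(V) with M, Q invertible. Assume: Q^{-1} = W^{-1}M^{-1}W; A commutes with Λ and A commutes with ψ − Q^{-1}; ψ + (qAM^{-1} − q^{-1}M^{-1}A)/(q^2 − q^{-2}) = ((a + a^{-1})/(q + q^{-1}))I; and M^{-1} + (qψA − q^{-1}Aψ)/(q^2 − q^{-2}) = Λ/(q + q^{-1}). Then (ψ − Q^{-1})((q + q^{-1})I − A) = (a + a^{-1})I − Λ. -/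
section OrthogonalIdempotents

variable {F R : Type*} [Field F] [Ring R] [Algebra F R] {n : ℕ} {E : ℕ → R}

theorem eq_zero_of_forall_idempotent_mul_mul_eq_zero
    (hsum : ∑ i ∈ Finset.range n, E i = 1) {X : R}
    (h : ∀ i < n, ∀ j < n, E i * X * E j = 0) : X = 0 := by
  calc X = (∑ i ∈ Finset.range n, E i) * X * ∑ j ∈ Finset.range n, E j := by
        rw [hsum, one_mul, mul_one]
    _ = 0 := by
        simp only [Finset.sum_mul, Finset.mul_sum]
        exact Finset.sum_eq_zero fun i hi => Finset.sum_eq_zero fun j hj =>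
          h _ (by simpa using hj) _ (by simpa using hi)

theorem idempotent_mul_sum_smul
    (hE : ∀ i < n, ∀ j < n, E i * E j = if i = j then E i else 0)
    (c : ℕ → F) {i : ℕ} (hi : i < n) :
    E i * ∑ j ∈ Finset.range n, c j • E j = c i • E i := by
  rw [Finset.mul_sum, Finset.sum_eq_single i]
  · rw [mul_smul_comm, hE i hi i hi, if_pos rfl]
  · intro j hj hji
    rw [mul_smul_comm, hE i hi j (by simpa using hj), if_neg hji.symm, smul_zero]
  · intro h
    exact absurd (Finset.mem_range.mpr hi) h

theorem sum_smul_mul_idempotent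
    (hE : ∀ i < n, ∀ j < n, E i * E j = if i = j then E i else 0)
    (c : ℕ → F) {i : ℕ} (hi : i < n) :
    (∑ j ∈ Finset.range n, c j • E j) * E i = c i • E i := by
  rw [Finset.sum_mul, Finset.sum_eq_single i]
  · rw [smul_mul_assoc, hE i hi i hi, if_pos rfl]
  · intro j hj hji
    rw [smul_mul_assoc, hE j (by simpa using hj) i hi, if_neg hji, smul_zero]
  · intro h
    exact absurd (Finset.mem_range.mpr hi) h

theorem mul_mul_eq_zero_of_commute_of_ne {A X e f : R} {α β : F}
    (he : e * A = α • e) (hf : A * f = β • f) (hAX : A * X = X * A) (hαβ : α ≠ β) :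
    e * X * f = 0 := by
  have h : α • (e * X * f) = β • (e * X * f) := by
    calc α • (e * X * f) = e * A * X * f := by rw [he, smul_mul_assoc, smul_mul_assoc]
      _ = e * X * (A * f) := by rw [mul_assoc e A X, hAX]; simp only [mul_assoc]
      _ = β • (e * X * f) := by rw [hf, mul_smul_comm]
  rw [← sub_eq_zero, ← sub_smul] at h
  exact (smul_eq_zero.mp h).resolve_left (sub_ne_zero.mpr hαβ)

end OrthogonalIdempotents

theorem stmt17
    {F : Type*} [Field F] {V : Type*} [AddCommGroup V] [Module F V]
    [FiniteDimensional F V] [Nontrivial V]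
    (q a : F) (hq0 : q ≠ 0) (ha0 : a ≠ 0) (hq4 : q ^ 4 ≠ 1)
    (d : ℕ) (hd : 1 ≤ d)
    (hq2i : ∀ i : ℕ, 1 ≤ i → i ≤ d → q ^ (2 * i) ≠ 1)
    (ha2 : ∀ j : ℤ, 1 - (d : ℤ) ≤ j → j ≤ (d : ℤ) - 1 → a ^ 2 ≠ q ^ (2 * j))
    (θ : ℕ → F)
    (hθ : ∀ i : ℕ, i ≤ d → θ i = a * q ^ ((d : ℤ) - 2 * (i : ℤ)) + a⁻¹ * q ^ (2 * (i : ℤ) - (d : ℤ)))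
    (hθdist : ∀ i j : ℕ, i ≤ d → j ≤ d → i ≠ j → θ i ≠ θ j)
    (A : Module.End F V) (E : ℕ → Module.End F V)
    (hEE : ∀ i j : ℕ, i ≤ d → j ≤ d → E i * E j = if i = j then E i else 0)
    (hEsum : ∑ i ∈ Finset.range (d + 1), E i = 1)
    (hAE : A = ∑ i ∈ Finset.range (d + 1), θ i • E i)
    (hEne : ∀ i : ℕ, i ≤ d → E i ≠ 0)
    (t : ℕ → F)
    (ht : ∀ i : ℕ, i ≤ d → t i = (-1 : F) ^ i * a ^ i * q ^ (i * (d - i)))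
    (W Winv : Module.End F V)
    (hW : W = ∑ i ∈ Finset.range (d + 1), t i • E i)
    (hWinv : Winv = ∑ i ∈ Finset.range (d + 1), (t i)⁻¹ • E i)
    (ψ M Q Minv Qinv Λ : Module.End F V)
    (hM : M * Minv = 1) (hM' : Minv * M = 1)
    (hQ : Q * Qinv = 1) (hQ' : Qinv * Q = 1)
    (hQM : Qinv = Winv * Minv * W)
    (hΛA : A * Λ = Λ * A)
    (hcom : A * (ψ - Qinv) = (ψ - Qinv) * A)
    (heq1 : ψ + (q ^ 2 - (q ^ 2)⁻¹)⁻¹ • (q • (A * Minv) - q⁻¹ • (Minv * A))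
        = ((a + a⁻¹) / (q + q⁻¹)) • 1)
    (heq3 : Minv + (q ^ 2 - (q ^ 2)⁻¹)⁻¹ • (q • (ψ * A) - q⁻¹ • (A * ψ)) = (q + q⁻¹)⁻¹ • Λ) :
    (ψ - Qinv) * ((q + q⁻¹) • 1 - A) = (a + a⁻¹) • 1 - Λ := by
  have hlt {i : ℕ} (hi : i < d + 1) : i ≤ d := Nat.lt_succ_iff.mp hi
  have hE : ∀ i < d + 1, ∀ j < d + 1, E i * E j = if i = j then E i else 0 :=
    fun i hi j hj => hEE i j (hlt hi) (hlt hj)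
  have hs : q + q⁻¹ ≠ 0 := by
    intro h
    field_simp at h
    exact hq4 (by linear_combination (q ^ 2 - 1) * h)
  have hr : q - q⁻¹ ≠ 0 := by
    intro h
    field_simp at h
    exact hq4 (by linear_combination (q ^ 2 + 1) * h)
  have hk : (q ^ 2 - (q ^ 2)⁻¹)⁻¹ * (q - q⁻¹) = (q + q⁻¹)⁻¹ := by
    have : q ^ 2 - (q ^ 2)⁻¹ = (q + q⁻¹) * (q - q⁻¹) := by
      field_simp
      ring
    rw [this, mul_inv, mul_assoc, inv_mul_cancel₀ hr, mul_one]
  rw [← sub_eq_zero]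
  refine eq_zero_of_forall_idempotent_mul_mul_eq_zero hEsum fun i hi j hj => ?_
  have hl : ∀ i < d + 1, E i * A = θ i • E i := fun i hi =>
    hAE ▸ idempotent_mul_sum_smul hE θ hi
  have hrt : ∀ i < d + 1, A * E i = θ i • E i := fun i hi =>
    hAE ▸ sum_smul_mul_idempotent hE θ hi
  by_cases hij : i = j
  · subst hij
    have hti : t i ≠ 0 := by
      rw [ht i (hlt hi)]
      exact mul_ne_zero (mul_ne_zero (pow_ne_zero _ (by simp)) (pow_ne_zero _ ha0))
        (pow_ne_zero _ hq0)
    have hQi : E i * Qinv * E i = E i * Minv * E i := by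
      calc E i * Qinv * E i = (E i * Winv) * Minv * (W * E i) := by
            rw [hQM]; simp only [mul_assoc]
        _ = E i * Minv * E i := by
            rw [hWinv, hW, idempotent_mul_sum_smul hE (fun j => (t j)⁻¹) hi,
              sum_smul_mul_idempotent hE t hi]
            simp only [smul_mul_assoc, mul_smul_comm, smul_smul, mul_inv_cancel₀ hti, one_smul]
    have hAX (X : Module.End F V) : E i * (A * X) * E i = θ i • (E i * X * E i) := by
      rw [← mul_assoc, hl i hi, smul_mul_assoc, smul_mul_assoc]
    have hXA (X : Module.End F V) : E i * (X * A) * E i = θ i • (E i * X * E i) := by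
      rw [← mul_assoc, mul_assoc, hrt i hi, mul_smul_comm]
    have hψ : E i * ψ * E i + ((q ^ 2 - (q ^ 2)⁻¹)⁻¹ * (q - q⁻¹) * θ i) • (E i * Minv * E i)
        = ((a + a⁻¹) / (q + q⁻¹)) • (E i * E i) := by
      have h := congrArg (fun X => E i * X * E i) heq1
      simp only [mul_add, add_mul, mul_sub, sub_mul, mul_smul_comm, smul_mul_assoc, hAX, hXA,
        mul_one, ← mul_smul] at h
      linear_combination (norm := module) h
    have hMinv : E i * Minv * E i + ((q ^ 2 - (q ^ 2)⁻¹)⁻¹ * (q - q⁻¹) * θ i) • (E i * ψ * E i)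
        = (q + q⁻¹)⁻¹ • (E i * Λ * E i) := by
      have h := congrArg (fun X => E i * X * E i) heq3
      simp only [mul_add, add_mul, mul_sub, sub_mul, mul_smul_comm, smul_mul_assoc, hAX, hXA] at h
      linear_combination (norm := module) h
    have h₁ := congrArg ((q + q⁻¹) • ·) hψ
    have h₂ := congrArg ((q + q⁻¹) • ·) hMinv
    simp only [hk, smul_add, smul_smul, mul_inv_cancel_left₀ hs, mul_inv_cancel₀ hs, one_smul,
      mul_div_cancel₀ _ hs] at h₁ h₂
    simp only [mul_sub, sub_mul, mul_smul_comm, smul_mul_assoc, hXA, mul_one, hQi]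
    linear_combination (norm := module) h₁ - h₂
  · refine mul_mul_eq_zero_of_commute_of_ne (hl i hi) (hrt j hj) ?_
      (hθdist i j (hlt hi) (hlt hj) hij)
    have hcomm : Commute A (ψ - Qinv) := hcom
    have hΛ : Commute A Λ := hΛA
    have hone (c : F) : Commute A (c • 1) := (Commute.one_right A).smul_right c
    exact ((hcomm.mul_right ((hone _).sub_right (Commute.refl A))).sub_right
      ((hone _).sub_right hΛ))
end
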